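/- arXiv:1202.4798 — 4 statements merged into one kernel-verified Lean document; each statement's English description precedes it below -/
import Mathlib

section
/- Let x = P(x) be a maxPPS or minPPS in SNF with least fixed point q*. Suppose 0 ≤ q ≤ q* with q < 1 (coordinatewise), and let σ be a policy such that P(q) = P_σ(q) and such that ρ(P'_σ(½(q* + q*_σ))) < 1 (so that (I − P'_σ(½(q* + q*_σ)))^{-1} exists and is entrywise nonnegative). Then ‖q*_σ − q*‖_∞ ≤ (2‖(I − P'_σ(½(q*_σ + q*)))^{-1}‖_∞ + 1)·‖q* − q‖_∞. -/
open Matrix Finset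

namespace PPS

/-- One equation of a max/min PPS in simple normal form (SNF):
form L (linear), form Q (product of two variables), or form M
(max or min of two variables, according to the kind of the system). -/
inductive Eqn (n : ℕ) where
  | lin (a0 : ℝ) (a : Fin n → ℝ) : Eqn n
  | quad (j k : Fin n) : Eqn n
  | m (j k : Fin n) : Eqn n

namespace Eqn

/-- Validity of the coefficients of a form-L equation: all coefficients,
including the constant term, are nonnegative and sum to at most 1. -/
def Valid {n : ℕ} : Eqn n → Prop
  | .lin a0 a => 0 ≤ a0 ∧ (∀ j, 0 ≤ a j) ∧ a0 + ∑ j, a j ≤ 1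
  | _ => True

/-- Evaluate one equation; `isMax` says whether form-M equations are max or min. -/
def eval {n : ℕ} (isMax : Bool) : Eqn n → (Fin n → ℝ) → ℝ
  | .lin a0 a, x => a0 + ∑ j, a j * x j
  | .quad j k, x => x j * x k
  | .m j k, x => if isMax then max (x j) (x k) else min (x j) (x k)

/-- An equation of form L or Q (no max/min). -/
def IsLinOrQuad {n : ℕ} : Eqn n → Prop
  | .m _ _ => False
  | _ => True

/-- Row of the Jacobian matrix of one (form L or Q) equation at the point `y`. -/
def jacRow {n : ℕ} : Eqn n → (Fin n → ℝ) → (Fin n → ℝ)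
  | .lin _ a, _ => a
  | .quad j k, y => fun l => (if l = j then y k else 0) + (if l = k then y j else 0)
  | .m _ _, _ => fun _ => 0

end Eqn

/-- A system of `n` equations in `n` variables, in SNF. -/
abbrev Sys (n : ℕ) : Type := Fin n → Eqn n

/-- All equations have valid (probabilistic) coefficients. -/
def SysValid {n : ℕ} (S : Sys n) : Prop := ∀ i, (S i).Valid

/-- A PPS: a system with no form-M equations. -/
def IsPPS {n : ℕ} (S : Sys n) : Prop := ∀ i, (S i).IsLinOrQuad

/-- The map `P : ℝ^n → ℝ^n` of the system. -/
def eval {n : ℕ} (isMax : Bool) (S : Sys n) (x : Fin n → ℝ) : Fin n → ℝ :=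
  fun i => (S i).eval isMax x

/-- The Jacobian matrix `P'(y)`. -/
def jac {n : ℕ} (S : Sys n) (y : Fin n → ℝ) : Matrix (Fin n) (Fin n) ℝ :=
  Matrix.of fun i l => (S i).jacRow y l

/-- `q` is the least fixed point of `x = P(x)` in `[0,1]^n`. -/
def IsLFP {n : ℕ} (isMax : Bool) (S : Sys n) (q : Fin n → ℝ) : Prop :=
  eval isMax S q = q ∧ (∀ i, 0 ≤ q i) ∧ (∀ i, q i ≤ 1) ∧
    (∀ q' : Fin n → ℝ, eval isMax S q' = q' → (∀ i, 0 ≤ q' i) → (∀ i, q' i ≤ 1) →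
      ∀ i, q i ≤ q' i)

/-- Applying a policy `σ` (a choice, for each form-M equation `max/min {x_j, x_k}`,
of one of the two variables: `true` picks `x_j`, `false` picks `x_k`) to the system,
yielding the PPS `x = P_σ(x)`. -/
def applyPolicy {n : ℕ} (S : Sys n) (σ : Fin n → Bool) : Sys n := fun i =>
  match S i with
  | .m j k => .lin 0 (fun l => if l = (if σ i then j else k) then 1 else 0)
  | e => e

/-- The linearization `P^y` of `P` at `y`: equations of form L and M are unchanged,
and a form-Q equation `x_j x_k` becomes `y_j x_k + x_j y_k - y_j y_k`. -/
def linEval {n : ℕ} (isMax : Bool) (S : Sys n) (y x : Fin n → ℝ) : Fin n → ℝ := fun i =>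
  match S i with
  | .quad j k => y j * x k + x j * y k - y j * y k
  | e => e.eval isMax x

/-- The Newton operator `N(y) = y + (I - P'(y))⁻¹ (P(y) - y)`. -/
noncomputable def newton {n : ℕ} (isMax : Bool) (S : Sys n) (y : Fin n → ℝ) : Fin n → ℝ :=
  y + (1 - jac S y)⁻¹ *ᵥ (eval isMax S y - y)

/-- the l∞ norm of a vector -/
noncomputable def vnorm {n : ℕ} (v : Fin n → ℝ) : ℝ := ⨆ i, |v i|

/-- the l∞ (max absolute row sum) norm of a matrix -/
noncomputable def mnorm {n : ℕ} (A : Matrix (Fin n) (Fin n) ℝ) : ℝ := ⨆ i, ∑ j, |A i j|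

end PPS
namespace PPS

variable {n : ℕ}

lemma abs_le_vnorm (v : Fin n → ℝ) (i : Fin n) : |v i| ≤ vnorm v :=
  le_ciSup (f := fun i => |v i|) (Set.finite_range _).bddAbove i

lemma vnorm_nonneg (v : Fin n → ℝ) : 0 ≤ vnorm v :=
  Real.iSup_nonneg fun _ => abs_nonneg _

lemma mnorm_nonneg (A : Matrix (Fin n) (Fin n) ℝ) : 0 ≤ mnorm A :=
  Real.iSup_nonneg fun _ => Finset.sum_nonneg fun _ _ => abs_nonneg _

lemma abs_mulVec_le (A : Matrix (Fin n) (Fin n) ℝ) {v : Fin n → ℝ} {d : ℝ} (hd : 0 ≤ d)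
    (hv : ∀ i, |v i| ≤ d) (i : Fin n) : |(A *ᵥ v) i| ≤ mnorm A * d := by
  calc |(A *ᵥ v) i| = |∑ j, A i j * v j| := rfl
    _ ≤ ∑ j, |A i j * v j| := Finset.abs_sum_le_sum_abs _ _
    _ ≤ ∑ j, |A i j| * d := by
        refine Finset.sum_le_sum fun j _ => ?_
        rw [abs_mul]
        exact mul_le_mul_of_nonneg_left (hv j) (abs_nonneg _)
    _ = (∑ j, |A i j|) * d := (Finset.sum_mul _ _ _).symm
    _ ≤ mnorm A * d := by
        refine mul_le_mul_of_nonneg_right ?_ hd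
        exact le_ciSup (f := fun i => ∑ j, |A i j|) (Set.finite_range _).bddAbove i

lemma isPPS_applyPolicy (S : Sys n) (σ : Fin n → Bool) : IsPPS (applyPolicy S σ) := by
  intro i
  cases h : S i <;> simp [applyPolicy, h, Eqn.IsLinOrQuad]

/-- The difference of two values of a PPS is given exactly by the Jacobian at the midpoint. -/
lemma eval_sub_eval_eq_jac_midpoint (isMax : Bool) {S : Sys n} (hS : IsPPS S)
    (x y : Fin n → ℝ) :
    eval isMax S x - eval isMax S y = jac S (fun i => (x i + y i) / 2) *ᵥ (x - y) := by
  funext i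
  have hi := hS i
  cases h : S i with
  | lin a0 a =>
    simp [eval, jac, Eqn.eval, Eqn.jacRow, h, Matrix.mulVec, dotProduct, mul_sub,
      Finset.sum_sub_distrib]
  | quad j k =>
    simp [eval, jac, Eqn.eval, Eqn.jacRow, h, Matrix.mulVec, dotProduct, add_mul,
      Finset.sum_add_distrib]
    ring
  | m j k => simp [h, Eqn.IsLinOrQuad] at hi

/-- If a policy attains the value of the system at `q`, its error at a larger point `x`
is at most the distance from `q` to `x`. -/
lemma abs_eval_applyPolicy_sub_eval_le (isMax : Bool) (S : Sys n) (σ : Fin n → Bool)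
    {q x : Fin n → ℝ} {d : ℝ} (hd : 0 ≤ d) (hqx : ∀ i, q i ≤ x i) (hxq : ∀ i, x i - q i ≤ d)
    (hσ : eval isMax S q = eval isMax (applyPolicy S σ) q) (i : Fin n) :
    |eval isMax (applyPolicy S σ) x i - eval isMax S x i| ≤ d := by
  have hi := congrFun hσ i
  cases h : S i with
  | lin a0 a => simpa [eval, applyPolicy, h, Eqn.eval] using hd
  | quad j k => simpa [eval, applyPolicy, h, Eqn.eval] using hd
  | m j k =>
    have := hqx j
    have := hqx k
    have := hxq j
    have := hxq k
    simp only [eval, applyPolicy, h, Eqn.eval] at hi ⊢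
    simp only [ite_mul, one_mul, zero_mul, Finset.sum_ite_eq',
      Finset.mem_univ, if_true, zero_add] at hi ⊢
    rw [abs_le]
    cases isMax <;> cases hs : σ i <;> simp [hs, -neg_le_sub_iff_le_add] at hi ⊢ <;> grind

lemma isUnit_one_sub_of_spectralRadius_lt_one {A : Matrix (Fin n) (Fin n) ℝ}
    (hA : spectralRadius ℂ (A.map (algebraMap ℝ ℂ)) < 1) : IsUnit (1 - A).det := by
  have h : (1 : ℂ) ∈ resolventSet ℂ (A.map (algebraMap ℝ ℂ)) :=
    spectrum.mem_resolventSet_of_spectralRadius_lt (by simpa using hA)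
  rw [spectrum.mem_resolventSet_iff, map_one, Matrix.isUnit_iff_isUnit_det] at h
  have hmap : (1 : Matrix (Fin n) (Fin n) ℂ) - A.map (algebraMap ℝ ℂ)
      = (algebraMap ℝ ℂ).mapMatrix (1 - A) := by
    rw [map_sub, map_one]; rfl
  rw [hmap, ← RingHom.map_det] at h
  exact (isUnit_map_iff (algebraMap ℝ ℂ) _).1 h

end PPS

open PPS in
/-- Let `x = P(x)` be a maxPPS or minPPS in SNF with LFP `q*`.  Suppose `0 ≤ q ≤ q*`
with `q < 1` coordinatewise, and `σ` is a policy with `P(q) = P_σ(q)` and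
`ρ(P'_σ(½(q* + q*_σ))) < 1` (so that the inverse exists and is entrywise
nonnegative).  Then `‖q*_σ - q*‖_∞ ≤ (2‖(I - P'_σ(½(q*_σ + q*)))⁻¹‖_∞ + 1)‖q* - q‖_∞`. -/
theorem stmt13 {n : ℕ} (isMax : Bool) (S : Sys n) (hval : SysValid S)
    (qs : Fin n → ℝ) (hqs : IsLFP isMax S qs)
    (q : Fin n → ℝ) (hq0 : ∀ i, 0 ≤ q i) (hqqs : ∀ i, q i ≤ qs i) (hq1 : ∀ i, q i < 1)
    (σ : Fin n → Bool) (hσ : eval isMax S q = eval isMax (applyPolicy S σ) q)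
    (qσ : Fin n → ℝ) (hqσ : IsLFP isMax (applyPolicy S σ) qσ)
    (hrad : spectralRadius ℂ
        ((jac (applyPolicy S σ) (fun i => (qs i + qσ i) / 2)).map (algebraMap ℝ ℂ)) < 1) :
    vnorm (fun i => qσ i - qs i) ≤
      (2 * mnorm ((1 - jac (applyPolicy S σ) (fun i => (qσ i + qs i) / 2))⁻¹) + 1) *
        vnorm (fun i => qs i - q i) := by
  have hcomm : (fun i => (qs i + qσ i) / 2) = fun i => (qσ i + qs i) / 2 := by
    funext i
    rw [add_comm]
  rw [hcomm] at hrad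
  set A := jac (applyPolicy S σ) (fun i => (qσ i + qs i) / 2) with hA
  set d := vnorm (fun i => qs i - q i) with hd
  have hd0 : 0 ≤ d := vnorm_nonneg _
  have hdist (i : Fin n) : qs i - q i ≤ d :=
    (le_abs_self _).trans (abs_le_vnorm (fun i => qs i - q i) i)
  have hunit := isUnit_one_sub_of_spectralRadius_lt_one hrad
  have hmid := eval_sub_eval_eq_jac_midpoint isMax (isPPS_applyPolicy S σ) qσ qs
  rw [hqσ.1, ← hA] at hmid
  have herr : qσ - qs = (1 - A)⁻¹ *ᵥ (eval isMax (applyPolicy S σ) qs - eval isMax S qs) := by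
    have h : (1 - A) *ᵥ (qσ - qs) = eval isMax (applyPolicy S σ) qs - eval isMax S qs := by
      rw [Matrix.sub_mulVec, Matrix.one_mulVec, ← hmid, hqs.1]
      abel
    rw [← h, Matrix.mulVec_mulVec, Matrix.nonsing_inv_mul _ hunit, Matrix.one_mulVec]
  have hM := mnorm_nonneg (1 - A)⁻¹
  refine Real.iSup_le (fun i => ?_) (by positivity)
  have hle := abs_mulVec_le (1 - A)⁻¹ hd0
    (abs_eval_applyPolicy_sub_eval_le isMax S σ hd0 hqqs hdist hσ) i
  have hi : qσ i - qs i = _ := congrFun herr i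
  change |qσ i - qs i| ≤ _
  rw [hi]
  refine hle.trans (mul_le_mul_of_nonneg_right ?_ hd0)
  linarith
end

section
/- Let x = P(x) be a PPS in SNF with least fixed point q* satisfying 0 < q* ≤ 1, and let y ∈ ℝ^n satisfy 0 ≤ y ≤ q* and y < 1 (coordinatewise). Then the matrix (I − P'(½(q* + y)))^{-1} exists and is entrywise nonnegative, and q* − y = (I − P'(½(q* + y)))^{-1}(P(y) − y). -/
open Matrix Finset

namespace PPS

namespace Eqn

variable {n : ℕ} {e : Eqn n}

lemma eval_nonneg (hv : e.Valid) (he : e.IsLinOrQuad) {x : Fin n → ℝ} (hx : 0 ≤ x) (b : Bool) :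
    0 ≤ e.eval b x := by
  cases e with
  | lin a0 a => exact add_nonneg hv.1 (sum_nonneg fun j _ => mul_nonneg (hv.2.1 j) (hx j))
  | quad j k => exact mul_nonneg (hx j) (hx k)
  | m j k => exact he.elim

lemma eval_mono (hv : e.Valid) (he : e.IsLinOrQuad) {x x' : Fin n → ℝ} (hx : 0 ≤ x)
    (hxx' : x ≤ x') (b : Bool) : e.eval b x ≤ e.eval b x' := by
  cases e with
  | lin a0 a =>
    exact add_le_add_right (sum_le_sum fun j _ => mul_le_mul_of_nonneg_left (hxx' j) (hv.2.1 j)) _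
  | quad j k => exact mul_le_mul (hxx' j) (hxx' k) (hx k) ((hx j).trans (hxx' j))
  | m j k => exact he.elim

lemma sum_jacRow_quad (j k : Fin n) (y w : Fin n → ℝ) :
    ∑ l, (quad j k).jacRow y l * w l = y k * w j + y j * w k := by
  simp [jacRow, add_mul, sum_add_distrib, ite_mul]

/-- For equations of degree at most two the midpoint form of the mean value theorem is exact. -/
lemma eval_sub_eval (he : e.IsLinOrQuad) {x y z : Fin n → ℝ}
    (hz : ∀ j, z j = (x j + y j) / 2) (b : Bool) :
    e.eval b x - e.eval b y = ∑ j, e.jacRow z j * (x j - y j) := by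
  cases e with
  | lin a0 a => simp [eval, jacRow, mul_sub, sum_sub_distrib]
  | quad j k =>
    rw [sum_jacRow_quad j k z fun l => x l - y l, hz, hz]
    simp only [eval]
    ring
  | m j k => exact he.elim

lemma jacRow_nonneg (hv : e.Valid) {x : Fin n → ℝ} (hx : 0 ≤ x) (l : Fin n) :
    0 ≤ e.jacRow x l := by
  cases e with
  | lin a0 a => exact hv.2.1 l
  | quad j k =>
    have := hx j
    have := hx k
    simp only [jacRow, Pi.zero_apply] at *
    positivity
  | m j k => exact le_rfl

lemma jacRow_mono {x x' : Fin n → ℝ} (hxx' : x ≤ x') (l : Fin n) :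
    e.jacRow x l ≤ e.jacRow x' l := by
  cases e with
  | lin a0 a => exact le_rfl
  | quad j k =>
    have := hxx' j
    have := hxx' k
    simp only [jacRow]
    gcongr <;> split_ifs <;> simp [*]
  | m j k => exact le_rfl

/-- An equation with value `1` depends only on the variables with value `1`. -/
lemma jacRow_eq_zero_of_eval_eq_one (hv : e.Valid) (he : e.IsLinOrQuad) {q : Fin n → ℝ}
    (hq0 : 0 ≤ q) (hq1 : q ≤ 1) {b : Bool} (h : e.eval b q = 1) {l : Fin n} (hl : q l < 1)
    (y : Fin n → ℝ) : e.jacRow y l = 0 := by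
  cases e with
  | lin a0 a =>
    obtain ⟨-, ha, hs⟩ := hv
    have hnn : ∀ j ∈ univ, 0 ≤ a j * (1 - q j) := fun j _ =>
      mul_nonneg (ha j) (sub_nonneg.2 (hq1 j))
    have hsum : ∑ j, a j * (1 - q j) ≤ 0 := by
      simp only [mul_sub, mul_one, sum_sub_distrib]
      simp only [eval] at h
      linarith
    have := (single_le_sum hnn (mem_univ l)).trans hsum
    simp only [jacRow]
    nlinarith [ha l]
  | quad j k =>
    simp only [eval] at h
    have hj := hq1 j
    have hk := hq1 k
    have hj0 := hq0 j
    have hk0 := hq0 k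
    simp only [Pi.one_apply, Pi.zero_apply] at hj hk hj0 hk0
    have hlj : l ≠ j := by
      rintro rfl
      nlinarith
    have hlk : l ≠ k := by
      rintro rfl
      nlinarith
    simp [jacRow, hlj, hlk]
  | m j k => exact he.elim

lemma sum_jacRow_mul_one_sub_le (hv : e.Valid) (he : e.IsLinOrQuad) {q z : Fin n → ℝ}
    (hq1 : q ≤ 1) (hzq : z ≤ q) (b : Bool) :
    ∑ j, e.jacRow z j * (1 - q j) ≤ 1 - e.eval b q := by
  cases e with
  | lin a0 a =>
    have := hv.2.2
    simp only [jacRow, eval, mul_sub, mul_one, sum_sub_distrib]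
    linarith
  | quad j k =>
    rw [sum_jacRow_quad j k z fun l => 1 - q l]
    have hj := hq1 j
    have hk := hq1 k
    have hzj := hzq j
    have hzk := hzq k
    simp only [Pi.one_apply, eval] at *
    nlinarith [mul_nonneg (sub_nonneg.2 hzj) (sub_nonneg.2 hk),
      mul_nonneg (sub_nonneg.2 hzk) (sub_nonneg.2 hj),
      mul_nonneg (sub_nonneg.2 hj) (sub_nonneg.2 hk)]
  | m j k => exact he.elim

/-- Equality in `sum_jacRow_mul_one_sub_le` forces the equation to be linear. -/
lemma jacRow_eq_of_sum_jacRow_eq (he : e.IsLinOrQuad) {q z : Fin n → ℝ}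
    (hq1 : q ≤ 1) (hzq : z ≤ q) (hz1 : ∀ j, z j < 1) {b : Bool}
    (h : 1 - e.eval b q ≤ ∑ j, e.jacRow z j * (1 - q j)) (hlt : e.eval b q < 1)
    (y : Fin n → ℝ) : e.jacRow y = e.jacRow z := by
  cases e with
  | lin a0 a => rfl
  | quad j k =>
    exfalso
    rw [sum_jacRow_quad j k z fun l => 1 - q l] at h
    have hj := hq1 j
    have hk := hq1 k
    have hzj := hzq j
    have hzk := hzq k
    have hzj1 := hz1 j
    have hzk1 := hz1 k
    simp only [Pi.one_apply, eval] at *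
    have h1 : 0 ≤ ((1 + q j) / 2 - z j) * (1 - q k) := mul_nonneg (by linarith) (by linarith)
    have h2 : 0 ≤ ((1 + q k) / 2 - z k) * (1 - q j) := mul_nonneg (by linarith) (by linarith)
    have h3 : ((1 + q j) / 2 - z j) * (1 - q k) = 0 := by nlinarith
    have h4 : ((1 + q k) / 2 - z k) * (1 - q j) = 0 := by nlinarith
    have hk' : q k = 1 := by
      rcases mul_eq_zero.1 h3 with h | h <;> linarith
    have hj' : q j = 1 := by
      rcases mul_eq_zero.1 h4 with h | h <;> linarith
    rw [hk', hj'] at hlt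
    linarith
  | m j k => exact he.elim

end Eqn

/-- A nonnegative matrix `A` without nonzero vectors `0 ≤ v ≤ A v` is such that `1 - A` is
invertible with nonnegative inverse. -/
lemma isUnit_one_sub_and_inv_nonneg {ι : Type*} [Fintype ι] [DecidableEq ι] {A : Matrix ι ι ℝ}
    (hA : ∀ i j, 0 ≤ A i j) (h : ∀ v : ι → ℝ, 0 ≤ v → v ≤ A *ᵥ v → v = 0) :
    IsUnit (1 - A) ∧ ∀ i j, 0 ≤ (1 - A)⁻¹ i j := by
  have hpos : ∀ x : ι → ℝ, 0 ≤ (1 - A) *ᵥ x → 0 ≤ x := by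
    intro x hx
    have hv := h (fun i => max (-x i) 0) (fun i => le_max_right _ _) fun i => by
      have hxi := hx i
      simp only [sub_mulVec, one_mulVec, Pi.sub_apply, Pi.zero_apply] at hxi
      have h1 : -(A *ᵥ x) i ≤ (A *ᵥ fun i => max (-x i) 0) i := by
        simp only [mulVec, dotProduct, ← sum_neg_distrib, ← mul_neg]
        exact sum_le_sum fun j _ => mul_le_mul_of_nonneg_left (le_max_left _ _) (hA i j)
      refine max_le (by linarith) ?_
      exact sum_nonneg fun j _ => mul_nonneg (hA i j) (le_max_right _ _)
    intro i
    have hi := congrFun hv i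
    have := le_max_left (-x i) 0
    simp only [Pi.zero_apply] at hi ⊢
    linarith
  have hU : IsUnit (1 - A) := by
    rw [← mulVec_injective_iff_isUnit]
    intro x x' hxx'
    refine le_antisymm ?_ ?_
    · exact sub_nonneg.1 (hpos _ (by rw [mulVec_sub]; exact (sub_eq_zero.2 hxx'.symm).ge))
    · exact sub_nonneg.1 (hpos _ (by rw [mulVec_sub]; exact (sub_eq_zero.2 hxx').ge))
  refine ⟨hU, fun i j => ?_⟩
  have hdet := (isUnit_iff_isUnit_det _).1 hU
  have := hpos ((1 - A)⁻¹ *ᵥ Pi.single j 1) (by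
    rw [mulVec_mulVec, mul_nonsing_inv _ hdet, one_mulVec]
    exact Pi.single_nonneg.2 zero_le_one) i
  simpa using this

lemma exists_pos_forall_mul_le {ι : Type*} [Finite ι] (u : ι → ℝ) {d : ι → ℝ}
    (hd : ∀ i, 0 < d i) : ∃ ε > 0, ∀ i, ε * u i ≤ d i := by
  have h : ∀ᶠ ε in nhdsWithin (0 : ℝ) (Set.Ioi 0), ∀ i, ε * u i < d i :=
    Filter.eventually_all.2 fun i => nhdsWithin_le_nhds <|
      (Continuous.tendsto (by fun_prop : Continuous fun ε : ℝ => ε * u i) 0).eventually_lt_const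
        (by simpa using hd i)
  obtain ⟨ε, hε, h0⟩ := (h.and self_mem_nhdsWithin).exists
  exact ⟨ε, h0, fun i => (hε i).le⟩

section LeastFixedPoint

variable {n : ℕ} {S : Sys n} {b : Bool} {q : Fin n → ℝ}

/-- The least fixed point lies below every nonnegative pre-fixed point under it. -/
lemma IsLFP.le_of_eval_le (hval : SysValid S) (hpps : IsPPS S) (hq : IsLFP b S q)
    {x : Fin n → ℝ} (hx : 0 ≤ x) (hxq : x ≤ q) (h : eval b S x ≤ x) : q ≤ x := by
  have : Fact ((0 : Fin n → ℝ) ≤ x) := ⟨hx⟩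
  let f : Set.Icc (0 : Fin n → ℝ) x →o Set.Icc (0 : Fin n → ℝ) x :=
    { toFun := fun p => ⟨eval b S p, fun i => (S i).eval_nonneg (hval i) (hpps i) p.2.1 b,
        fun i => ((S i).eval_mono (hval i) (hpps i) p.2.1 p.2.2 b).trans (h i)⟩
      monotone' := fun p p' hp i => (S i).eval_mono (hval i) (hpps i) p.2.1 hp b }
  have hfix : eval b S f.lfp.1 = f.lfp.1 := congrArg Subtype.val f.map_lfp
  exact fun i => (hq.2.2.2 _ hfix f.lfp.2.1
    (fun j => (f.lfp.2.2 j).trans ((hxq j).trans (hq.2.2.1 j))) i).trans (f.lfp.2.2 i)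

/-- One cannot descend from the least fixed point along a nonnegative direction `u` with
`u ≤ P'(q - (ε / 2) u) u` on the support of `u`. -/
lemma IsLFP.eq_zero_of_le_jacRow (hval : SysValid S) (hpps : IsPPS S) (hq : IsLFP b S q)
    {u : Fin n → ℝ} (hu : 0 ≤ u) {ε : ℝ} (hε : 0 < ε) (hεu : ∀ i, ε * u i ≤ q i)
    (h : ∀ i, u i ≠ 0 → u i ≤ ∑ j, (S i).jacRow (fun l => q l - ε * u l / 2) j * u j) :
    u = 0 := by
  have hle : (fun i => q i - ε * u i) ≤ q := fun i => sub_le_self _ (mul_nonneg hε.le (hu i))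
  have hnn : 0 ≤ fun i => q i - ε * u i := fun i => sub_nonneg.2 (hεu i)
  have key := hq.le_of_eval_le hval hpps hnn hle fun i => by
    have hqi : (S i).eval b q = q i := congrFun hq.1 i
    change (S i).eval b (fun i => q i - ε * u i) ≤ q i - ε * u i
    by_cases hi : u i = 0
    · rw [hi, mul_zero, sub_zero]
      exact ((S i).eval_mono (hval i) (hpps i) hnn hle b).trans_eq hqi
    · have hsub := (S i).eval_sub_eval (hpps i) (x := q) (y := fun i => q i - ε * u i)
        (z := fun l => q l - ε * u l / 2) (fun j => by ring) b
      have hs : ∑ j, (S i).jacRow (fun l => q l - ε * u l / 2) j * (q j - (q j - ε * u j))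
          = ε * ∑ j, (S i).jacRow (fun l => q l - ε * u l / 2) j * u j := by
        rw [mul_sum]
        exact sum_congr rfl fun j _ => by ring
      have := mul_le_mul_of_nonneg_left (h i hi) hε.le
      linarith
  ext i
  have h1 := key i
  have h2 := hu i
  simp only [Pi.zero_apply] at h2 ⊢
  nlinarith

/-- Below the least fixed point and strictly below `1`, the Jacobian of a PPS has no nonzero
vector `0 ≤ v ≤ P'(z) v`. -/
lemma IsLFP.eq_zero_of_le_jac_mulVec (hval : SysValid S) (hpps : IsPPS S) (hq : IsLFP b S q)
    (hqpos : ∀ i, 0 < q i) {z : Fin n → ℝ} (hz0 : 0 ≤ z) (hzq : z ≤ q) (hz1 : ∀ i, z i < 1)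
    {v : Fin n → ℝ} (hv : 0 ≤ v) (hAv : v ≤ jac S z *ᵥ v) : v = 0 := by
  have hq1 : q ≤ 1 := hq.2.2.1
  have heval : ∀ i, (S i).eval b q = q i := congrFun hq.1
  have hAv' : ∀ i, v i ≤ ∑ j, (S i).jacRow z j * v j := hAv
  have hone : ∀ i, q i = 1 → v i = 0 := by
    set u : Fin n → ℝ := fun i => if q i = 1 then v i else 0 with hu_def
    have hu : 0 ≤ u := fun i => by
      simp only [hu_def]
      split_ifs
      exacts [hv i, le_rfl]
    obtain ⟨ε, hε, hεu⟩ := exists_pos_forall_mul_le u fun i => sub_pos.2 (hz1 i)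
    have hεq : ∀ i, ε * u i ≤ q i - z i := fun i => by
      by_cases hi : q i = 1
      · rw [hi]
        exact hεu i
      · simpa [hu_def, hi] using hzq i
    have := hq.eq_zero_of_le_jacRow hval hpps hu hε
      (fun i => (hεq i).trans (sub_le_self _ (hz0 i))) fun i hi => by
        have hqi : q i = 1 := by
          by_contra hne
          exact hi (by simp [hu_def, hne])
        calc u i = v i := by simp [hu_def, hqi]
          _ ≤ ∑ j, (S i).jacRow z j * v j := hAv' i
          _ = ∑ j, (S i).jacRow z j * u j := sum_congr rfl fun j _ => by
            by_cases hj : q j = 1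
            · simp [hu_def, hj]
            · rw [(S i).jacRow_eq_zero_of_eval_eq_one (hval i) (hpps i) hq.2.1 hq1
                ((heval i).trans hqi) (lt_of_le_of_ne (hq1 j) hj), zero_mul, zero_mul]
          _ ≤ _ := sum_le_sum fun j _ => mul_le_mul_of_nonneg_right
            (Eqn.jacRow_mono (fun l => by
              have h1 := hεq l
              have h2 := mul_nonneg hε.le (hu l)
              change z l ≤ q l - ε * u l / 2
              linarith) j) (hu j)
    intro i hi
    simpa [hu_def, hi] using congrFun this i
  by_contra hne
  obtain ⟨k, hk⟩ := Function.ne_iff.1 hne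
  have hvk : 0 < v k := lt_of_le_of_ne (hv k) (Ne.symm hk)
  have hw : ∀ i, 0 ≤ 1 - q i := fun i => sub_nonneg.2 (hq1 i)
  have hwk : 0 < 1 - q k := lt_of_le_of_ne (hw k) fun h0 => hk (hone k (by linarith))
  obtain ⟨m, -, hm⟩ := exists_max_image univ (fun i => v i / (1 - q i)) ⟨k, mem_univ k⟩
  obtain ⟨t, ht⟩ : ∃ t, t = v m / (1 - q m) := ⟨_, rfl⟩
  rw [← ht] at hm
  have htpos : 0 < t := (div_pos hvk hwk).trans_le (hm k (mem_univ k))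
  have hwm : 1 - q m ≠ 0 := by
    intro h0
    rw [h0, div_zero] at ht
    exact htpos.ne' ht
  have hvt : ∀ i, v i ≤ t * (1 - q i) := fun i => by
    rcases (hw i).eq_or_lt with h0 | hpos
    · rw [← h0, mul_zero, hone i (by linarith)]
    · exact (div_le_iff₀ hpos).1 (hm i (mem_univ i))
  set u : Fin n → ℝ := fun i => if v i = t * (1 - q i) then 1 - q i else 0 with hu_def
  have hu : 0 ≤ u := fun i => by
    simp only [hu_def]
    split_ifs
    exacts [hw i, le_rfl]
  obtain ⟨ε, hε, hεu⟩ := exists_pos_forall_mul_le u hqpos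
  have := hq.eq_zero_of_le_jacRow hval hpps hu hε hεu fun i hi => by
    have hvi : v i = t * (1 - q i) := by
      by_contra hne
      exact hi (by simp [hu_def, hne])
    have hui : u i = 1 - q i := by simp [hu_def, hvi]
    have hqi : q i < 1 := sub_pos.1 (lt_of_le_of_ne (hw i) (by rw [← hui]; exact hi.symm))
    have hA : ∀ j, 0 ≤ (S i).jacRow z j := (S i).jacRow_nonneg (hval i) hz0
    have hle := (S i).sum_jacRow_mul_one_sub_le (hval i) (hpps i) hq1 hzq b
    rw [heval] at hle
    have hnn : ∀ j ∈ univ, 0 ≤ (S i).jacRow z j * (t * (1 - q j) - v j) := fun j _ =>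
      mul_nonneg (hA j) (sub_nonneg.2 (hvt j))
    have hsum : ∑ j, (S i).jacRow z j * (t * (1 - q j) - v j)
        = t * ∑ j, (S i).jacRow z j * (1 - q j) - ∑ j, (S i).jacRow z j * v j := by
      rw [mul_sum, ← sum_sub_distrib]
      exact sum_congr rfl fun j _ => by ring
    have hvle := hAv' i
    have hnns := sum_nonneg hnn
    have hge : 1 - q i ≤ ∑ j, (S i).jacRow z j * (1 - q j) := by
      refine le_of_mul_le_mul_left ?_ htpos
      linarith
    have hzero : ∑ j, (S i).jacRow z j * (t * (1 - q j) - v j) = 0 := by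
      have := mul_le_mul_of_nonneg_left hle htpos.le
      linarith
    have hterm := (sum_eq_zero_iff_of_nonneg hnn).1 hzero
    rw [Eqn.jacRow_eq_of_sum_jacRow_eq (hpps i) hq1 hzq hz1 (b := b) (by rwa [heval])
      (by rwa [heval]), hui]
    refine hge.trans_eq (sum_congr rfl fun j _ => ?_)
    by_cases hj : v j = t * (1 - q j)
    · simp [hu_def, hj]
    · rw [(mul_eq_zero.1 (hterm j (mem_univ j))).resolve_right
        fun h0 => hj (sub_eq_zero.1 h0).symm, zero_mul, zero_mul]
  have hum := congrFun this m
  have hvm : v m = t * (1 - q m) := by rw [ht, div_mul_cancel₀ _ hwm]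
  simp only [hu_def, ← hvm, if_true, Pi.zero_apply] at hum
  exact hwm hum

end LeastFixedPoint

end PPS

open PPS in
/-- Let `x = P(x)` be a PPS in SNF with LFP `0 < q* ≤ 1`, and `0 ≤ y ≤ q*` with
`y < 1` coordinatewise.  Then `(I - P'(½(q* + y)))⁻¹` exists and is entrywise
nonnegative, and `q* - y = (I - P'(½(q* + y)))⁻¹ (P(y) - y)`. -/
theorem stmt14 {n : ℕ} (S : Sys n) (hval : SysValid S) (hpps : IsPPS S)
    (q : Fin n → ℝ) (hq : IsLFP true S q) (hqpos : ∀ i, 0 < q i)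
    (y : Fin n → ℝ) (hy0 : ∀ i, 0 ≤ y i) (hyq : ∀ i, y i ≤ q i) (hy1 : ∀ i, y i < 1) :
    IsUnit (1 - jac S (fun i => (q i + y i) / 2)) ∧
    (∀ i j, 0 ≤ ((1 - jac S (fun i => (q i + y i) / 2))⁻¹) i j) ∧
    q - y = (1 - jac S (fun i => (q i + y i) / 2))⁻¹ *ᵥ (eval true S y - y) := by
  have hz0 : (0 : Fin n → ℝ) ≤ fun i => (q i + y i) / 2 := fun i => by
    have := hqpos i
    have := hy0 i
    simp only [Pi.zero_apply]
    positivity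
  have hzq : (fun i => (q i + y i) / 2) ≤ q := fun i => by
    have := hyq i
    change (q i + y i) / 2 ≤ q i
    linarith
  have hz1 : ∀ i, (q i + y i) / 2 < 1 := fun i => by
    have := hy1 i
    have := hq.2.2.1 i
    linarith
  obtain ⟨hU, hnn⟩ := isUnit_one_sub_and_inv_nonneg
    (A := jac S fun i => (q i + y i) / 2) (fun i j => (S i).jacRow_nonneg (hval i) hz0 j)
    fun v hv hAv => hq.eq_zero_of_le_jac_mulVec hval hpps hqpos hz0 hzq hz1 hv hAv
  refine ⟨hU, hnn, ?_⟩
  have hmul : (1 - jac S fun i => (q i + y i) / 2) *ᵥ (q - y) = eval true S y - y := by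
    ext i
    have hsub : q i - (S i).eval true y
        = (jac S (fun i => (q i + y i) / 2) *ᵥ (q - y)) i := by
      have := (S i).eval_sub_eval (hpps i) (x := q) (y := y)
        (z := fun i => (q i + y i) / 2) (fun _ => rfl) true
      rwa [show (S i).eval true q = q i from congrFun hq.1 i] at this
    have hdef : eval true S y i = (S i).eval true y := rfl
    simp only [sub_mulVec, one_mulVec, Pi.sub_apply, hdef]
    rw [← hsub]
    ring
  rw [← hmul, mulVec_mulVec, nonsing_inv_mul _ ((isUnit_iff_isUnit_det _).1 hU), one_mulVec]
end

section
/- Let x = P(x) be a maxPPS or minPPS in SNF with least fixed point q*, and let y ∈ ℝ^n with 0 ≤ y ≤ q*. Then ‖P(y) − y‖_∞ ≤ 2‖q* − y‖_∞. -/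
open Matrix Finset

namespace PPS

/-- Below a point `q` of the unit cube, an SNF equation is monotone, and its increment up to `q` is
at most twice the coordinatewise distance. -/
theorem Eqn.eval_sub_mem_Icc {n : ℕ} (isMax : Bool) (e : Eqn n) (he : e.Valid)
    {q y : Fin n → ℝ} {d : ℝ} (hd : 0 ≤ d) (hq1 : ∀ i, q i ≤ 1)
    (hy0 : ∀ i, 0 ≤ y i) (hyq : ∀ i, y i ≤ q i) (hqy : ∀ i, q i - y i ≤ d) :
    e.eval isMax q - e.eval isMax y ∈ Set.Icc 0 (2 * d) := by
  cases e with
  | lin a0 a =>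
    obtain ⟨ha0, ha, hsum⟩ := he
    have key : Eqn.eval isMax (.lin a0 a) q - Eqn.eval isMax (.lin a0 a) y
        = ∑ j, a j * (q j - y j) := by
      simp only [Eqn.eval, mul_sub, Finset.sum_sub_distrib]
      ring
    have hle : ∑ j, a j * (q j - y j) ≤ (∑ j, a j) * d := by
      rw [Finset.sum_mul]
      exact Finset.sum_le_sum fun j _ => mul_le_mul_of_nonneg_left (hqy j) (ha j)
    rw [key]
    refine ⟨Finset.sum_nonneg fun j _ => mul_nonneg (ha j) (sub_nonneg.2 (hyq j)), ?_⟩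
    nlinarith
  | quad j k =>
    have key : Eqn.eval isMax (.quad j k) q - Eqn.eval isMax (.quad j k) y
        = q j * (q k - y k) + y k * (q j - y j) := by
      simp only [Eqn.eval]
      ring
    have hj := sub_nonneg.2 (hyq j)
    have hk := sub_nonneg.2 (hyq k)
    have hqj := (hy0 j).trans (hyq j)
    have h₁ := mul_le_of_le_one_left hk (hq1 j)
    have h₂ := mul_le_of_le_one_left hj ((hyq k).trans (hq1 k))
    rw [key]
    refine ⟨add_nonneg (mul_nonneg hqj hk) (mul_nonneg (hy0 k) hj), ?_⟩
    linarith [hqy j, hqy k]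
  | m j k =>
    have := hyq j
    have := hyq k
    have := hqy j
    have := hqy k
    simp only [Eqn.eval, Set.mem_Icc]
    grind

end PPS

open PPS in
/-- Let `x = P(x)` be a maxPPS or minPPS in SNF with LFP `q*`, and `0 ≤ y ≤ q*`.
Then `‖P(y) - y‖_∞ ≤ 2‖q* - y‖_∞`. -/
theorem stmt15 {n : ℕ} (isMax : Bool) (S : Sys n) (hval : SysValid S)
    (q : Fin n → ℝ) (hq : IsLFP isMax S q)
    (y : Fin n → ℝ) (hy0 : ∀ i, 0 ≤ y i) (hyq : ∀ i, y i ≤ q i) :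
    vnorm (fun i => eval isMax S y i - y i) ≤ 2 * vnorm (fun i => q i - y i) := by
  obtain ⟨hfix, -, hq1, -⟩ := hq
  set d := vnorm (fun i => q i - y i) with hd_def
  have hd : 0 ≤ d := Real.iSup_nonneg fun i => abs_nonneg _
  have hqy : ∀ i, q i - y i ≤ d := fun i =>
    (le_abs_self _).trans (le_ciSup (f := fun i => |q i - y i|) (Set.finite_range _).bddAbove i)
  refine Real.iSup_le (fun i => ?_) (by positivity)
  obtain ⟨h₀, h₁⟩ := (S i).eval_sub_mem_Icc isMax (hval i) hd hq1 hy0 hyq hqy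
  have hi : (S i).eval isMax q = q i := congrFun hfix i
  rw [hi] at h₀ h₁
  simp only [eval]
  rw [abs_le]
  constructor <;> linarith [hqy i, hyq i]
end

section
/- Let A be an n×n entrywise nonnegative real matrix, let u ∈ ℝ^n be a vector with u > 0 (coordinatewise), Au ≤ u, and ‖u‖_∞ ≤ 1, and let α, β ∈ (0,1) be constants such that for every index i ∈ {1,…,n} one of the following holds: (I) (Au)_i ≤ (1 − β)u_i, or (II) there exist k with 1 ≤ k ≤ n and an index j such that (A^k)_{ij} ≥ α and (Au)_j ≤ (1 − β)u_j. Then (I − A) is nonsingular and ‖(I − A)^{-1}‖_∞ ≤ n/(u_min² · α · β), where u_min = min_i u_i. -/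
open Matrix Finset

/-- the l∞ norm of a vector -/
noncomputable def vnorm {n : ℕ} (v : Fin n → ℝ) : ℝ := ⨆ i, |v i|

/-- the l∞ (max absolute row sum) norm of a matrix -/
noncomputable def mnorm {n : ℕ} (A : Matrix (Fin n) (Fin n) ℝ) : ℝ := ⨆ i, ∑ j, |A i j|

section NonnegMatrix

variable {ι : Type*} [Fintype ι] {A : Matrix ι ι ℝ} {u : ι → ℝ}

lemma mulVec_le_mulVec_of_nonneg (hA : ∀ i j, 0 ≤ A i j) {v w : ι → ℝ} (h : v ≤ w) :
    A *ᵥ v ≤ A *ᵥ w :=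
  fun i => Finset.sum_le_sum fun j _ => mul_le_mul_of_nonneg_left (h j) (hA i j)

variable [DecidableEq ι]

lemma pow_entry_nonneg (hA : ∀ i j, 0 ≤ A i j) (k : ℕ) (i j : ι) : 0 ≤ (A ^ k) i j := by
  induction k generalizing i j with
  | zero => rw [pow_zero, Matrix.one_apply]; positivity
  | succ k ih =>
    rw [pow_succ, Matrix.mul_apply]
    exact Finset.sum_nonneg fun l _ => mul_nonneg (ih i l) (hA l j)

lemma pow_mulVec_le (hA : ∀ i j, 0 ≤ A i j) {v : ι → ℝ} (h : A *ᵥ v ≤ v) (k : ℕ) :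
    (A ^ k) *ᵥ v ≤ v := by
  induction k with
  | zero => simp
  | succ k ih =>
    rw [pow_succ, ← Matrix.mulVec_mulVec]
    exact (mulVec_le_mulVec_of_nonneg (pow_entry_nonneg hA k) h).trans ih

/-- If some power of `A` strictly decreases each coordinate of the positive vector `u`, then
every `y` with `A y ≤ y` is nonnegative. -/
lemma nonneg_of_mulVec_le (hA : ∀ i j, 0 ≤ A i j) (hu : ∀ i, 0 < u i)
    (hpow : ∀ i, ∃ k : ℕ, ((A ^ k) *ᵥ u) i < u i) {y : ι → ℝ} (hy : A *ᵥ y ≤ y) : 0 ≤ y := by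
  by_contra hneg
  obtain ⟨i₀, hi₀⟩ : ∃ i, y i < 0 := by simpa [Pi.le_def] using hneg
  obtain ⟨i, -, hi⟩ := Finset.exists_min_image Finset.univ (fun i => y i / u i) ⟨i₀, mem_univ i₀⟩
  set t := y i / u i with ht
  have ht0 : t < 0 := (hi i₀ (mem_univ _)).trans_lt (div_neg_of_neg_of_pos hi₀ (hu i₀))
  have hle : t • u ≤ y := fun l => (le_div_iff₀ (hu l)).1 (hi l (mem_univ _))
  obtain ⟨k, hk⟩ := hpow i
  have h1 := (mulVec_le_mulVec_of_nonneg (pow_entry_nonneg hA k) hle i).trans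
    (pow_mulVec_le hA hy k i)
  rw [Matrix.mulVec_smul, Pi.smul_apply, smul_eq_mul] at h1
  have h2 : y i = t * u i := (div_mul_cancel₀ _ (hu i).ne').symm
  nlinarith

lemma isUnit_one_sub (hA : ∀ i j, 0 ≤ A i j) (hu : ∀ i, 0 < u i)
    (hpow : ∀ i, ∃ k : ℕ, ((A ^ k) *ᵥ u) i < u i) : IsUnit (1 - A) := by
  rw [← Matrix.mulVec_injective_iff_isUnit]
  have key : ∀ x y : ι → ℝ, (1 - A) *ᵥ x = (1 - A) *ᵥ y → y ≤ x := by
    intro x y h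
    have h0 : (1 - A) *ᵥ (x - y) = 0 := by rw [Matrix.mulVec_sub, h, sub_self]
    rw [Matrix.sub_mulVec, Matrix.one_mulVec, sub_eq_zero] at h0
    exact sub_nonneg.1 (nonneg_of_mulVec_le hA hu hpow h0.ge)
  exact fun x y h => le_antisymm (key y x h.symm) (key x y h)

lemma inv_one_sub_nonneg (hA : ∀ i j, 0 ≤ A i j) (hu : ∀ i, 0 < u i)
    (hpow : ∀ i, ∃ k : ℕ, ((A ^ k) *ᵥ u) i < u i) (i j : ι) : 0 ≤ (1 - A)⁻¹ i j := by
  have hdet := (Matrix.isUnit_iff_isUnit_det _).1 (isUnit_one_sub hA hu hpow)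
  refine nonneg_of_mulVec_le hA hu hpow (y := fun l => (1 - A)⁻¹ l j) (fun l => ?_) i
  have h := congrFun (congrFun (Matrix.mul_nonsing_inv _ hdet) l) j
  rw [Matrix.sub_mul, Matrix.one_mul, Matrix.sub_apply] at h
  have h1 : (0 : ℝ) ≤ (1 : Matrix ι ι ℝ) l j := by rw [Matrix.one_apply]; positivity
  have h2 : (A *ᵥ fun l => (1 - A)⁻¹ l j) l = (A * (1 - A)⁻¹) l j := rfl
  linarith

lemma inv_one_sub_mul_pow_le (hA : ∀ i j, 0 ≤ A i j) (hunit : IsUnit (1 - A)) (k : ℕ) (i j : ι) :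
    ((1 - A)⁻¹ * A ^ k) i j ≤ (1 - A)⁻¹ i j := by
  have hdet := (Matrix.isUnit_iff_isUnit_det _).1 hunit
  induction k generalizing j with
  | zero => simp
  | succ k ih =>
    have h := congrFun (congrFun (Matrix.nonsing_inv_mul _ hdet) i) j
    rw [Matrix.mul_sub, Matrix.mul_one, Matrix.sub_apply] at h
    have h1 : (0 : ℝ) ≤ (1 : Matrix ι ι ℝ) i j := by rw [Matrix.one_apply]; positivity
    have h2 : ((1 - A)⁻¹ * A ^ (k + 1)) i j ≤ ((1 - A)⁻¹ * A) i j := by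
      rw [pow_succ, ← Matrix.mul_assoc, Matrix.mul_apply, Matrix.mul_apply]
      exact Finset.sum_le_sum fun l _ => mul_le_mul_of_nonneg_right (ih l) (hA l j)
    linarith

variable {α β : ℝ}

lemma exists_pow_mulVec_lt (hA : ∀ i j, 0 ≤ A i j) (hu : ∀ i, 0 < u i) (hAu : A *ᵥ u ≤ u)
    (hα : 0 < α) (hβ : 0 < β)
    (hcond : ∀ i, ∃ k : ℕ, ∃ j, α ≤ (A ^ k) i j ∧ (A *ᵥ u) j ≤ (1 - β) * u j) (i : ι) :
    ∃ k : ℕ, ((A ^ k) *ᵥ u) i < u i := by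
  obtain ⟨k, j, hk, hj⟩ := hcond i
  refine ⟨k + 1, lt_of_lt_of_le ?_ (pow_mulVec_le hA hAu k i)⟩
  rw [pow_succ, ← Matrix.mulVec_mulVec]
  have hlt : (A *ᵥ u) j < u j := by nlinarith [mul_pos hβ (hu j)]
  exact Finset.sum_lt_sum
    (fun l _ => mul_le_mul_of_nonneg_left (hAu l) (pow_entry_nonneg hA k i l))
    ⟨j, mem_univ j, mul_lt_mul_of_pos_left hlt (hα.trans_le hk)⟩

/-- The entries of `(1 - A)⁻¹` are bounded through columns in which `A` contracts `u`. -/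
lemma inv_one_sub_entry_le (hA : ∀ i j, 0 ≤ A i j) (hu : ∀ i, 0 < u i) (hAu : A *ᵥ u ≤ u)
    (hβ : 0 < β) (hpow : ∀ i, ∃ k : ℕ, ((A ^ k) *ᵥ u) i < u i)
    {i j : ι} {k : ℕ} (hk : α ≤ (A ^ k) i j) (hj : (A *ᵥ u) j ≤ (1 - β) * u j) (x : ι) :
    α * β * u j * (1 - A)⁻¹ x i ≤ u x := by
  have hunit := isUnit_one_sub hA hu hpow
  have hdet := (Matrix.isUnit_iff_isUnit_det _).1 hunit
  have hN := inv_one_sub_nonneg hA hu hpow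
  have h1 : (1 - A)⁻¹ x i * α ≤ (1 - A)⁻¹ x j :=
    calc (1 - A)⁻¹ x i * α ≤ (1 - A)⁻¹ x i * (A ^ k) i j :=
          mul_le_mul_of_nonneg_left hk (hN x i)
      _ ≤ ((1 - A)⁻¹ * A ^ k) x j := by
          rw [Matrix.mul_apply]
          exact Finset.single_le_sum (f := fun l => (1 - A)⁻¹ x l * (A ^ k) l j)
            (fun l _ => mul_nonneg (hN x l) (pow_entry_nonneg hA k l j)) (mem_univ i)
      _ ≤ (1 - A)⁻¹ x j := inv_one_sub_mul_pow_le hA hunit k x j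
  have h2 : (1 - A)⁻¹ x j * (β * u j) ≤ u x :=
    calc (1 - A)⁻¹ x j * (β * u j) ≤ (1 - A)⁻¹ x j * (u - A *ᵥ u) j :=
          mul_le_mul_of_nonneg_left (by rw [Pi.sub_apply]; linarith) (hN x j)
      _ ≤ ((1 - A)⁻¹ *ᵥ (u - A *ᵥ u)) x :=
          Finset.single_le_sum (f := fun l => (1 - A)⁻¹ x l * (u - A *ᵥ u) l)
            (fun l _ => mul_nonneg (hN x l) (sub_nonneg.2 (hAu l))) (mem_univ j)
      _ = u x := by
          have h : u - A *ᵥ u = (1 - A) *ᵥ u := by rw [Matrix.sub_mulVec, Matrix.one_mulVec]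
          rw [h, Matrix.mulVec_mulVec, Matrix.nonsing_inv_mul _ hdet, Matrix.one_mulVec]
  calc α * β * u j * (1 - A)⁻¹ x i = (1 - A)⁻¹ x i * α * (β * u j) := by ring
    _ ≤ (1 - A)⁻¹ x j * (β * u j) :=
        mul_le_mul_of_nonneg_right h1 (mul_pos hβ (hu j)).le
    _ ≤ u x := h2

end NonnegMatrix

/-- Let `A` be an `n×n` entrywise nonnegative matrix and `u > 0` with `Au ≤ u` and
`‖u‖_∞ ≤ 1`, and let `α, β ∈ (0,1)` be such that for every index `i` either
(I) `(Au)_i ≤ (1-β)u_i`, or (II) there are `1 ≤ k ≤ n` and `j` with `(A^k)_{ij} ≥ α`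
and `(Au)_j ≤ (1-β)u_j`.  Then `I - A` is nonsingular and
`‖(I-A)⁻¹‖_∞ ≤ n/(u_min² α β)`. -/
theorem stmt18 {n : ℕ} (A : Matrix (Fin n) (Fin n) ℝ) (hA : ∀ i j, 0 ≤ A i j)
    (u : Fin n → ℝ) (hu : ∀ i, 0 < u i) (hAu : ∀ i, (A *ᵥ u) i ≤ u i)
    (hun : vnorm u ≤ 1)
    (α β : ℝ) (hα : α ∈ Set.Ioo (0 : ℝ) 1) (hβ : β ∈ Set.Ioo (0 : ℝ) 1)
    (hcond : ∀ i, (A *ᵥ u) i ≤ (1 - β) * u i ∨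
      ∃ k : ℕ, 1 ≤ k ∧ k ≤ n ∧ ∃ j, α ≤ (A ^ k) i j ∧ (A *ᵥ u) j ≤ (1 - β) * u j) :
    IsUnit (1 - A) ∧
    mnorm ((1 - A)⁻¹) ≤ (n : ℝ) / ((⨅ i, u i) ^ 2 * α * β) := by
  obtain ⟨hα0, hα1⟩ := hα
  obtain ⟨hβ0, -⟩ := hβ
  have hcond' : ∀ i, ∃ k : ℕ, ∃ j, α ≤ (A ^ k) i j ∧ (A *ᵥ u) j ≤ (1 - β) * u j := by
    intro i
    rcases hcond i with h | ⟨k, -, -, j, h⟩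
    · exact ⟨0, i, by simpa using hα1.le, h⟩
    · exact ⟨k, j, h⟩
  have hpow := exists_pow_mulVec_lt hA hu hAu hα0 hβ0 hcond'
  refine ⟨isUnit_one_sub hA hu hpow, Real.iSup_le (fun x => ?_) (by positivity)⟩
  have : Nonempty (Fin n) := ⟨x⟩
  have hu1 : ∀ i, u i ≤ 1 := fun i =>
    (le_abs_self _).trans ((le_ciSup (f := fun i => |u i|) (Set.finite_range _).bddAbove i).trans hun)
  have hmin : ∀ i, (⨅ i, u i) ≤ u i := fun i => ciInf_le (Set.finite_range u).bddBelow i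
  obtain ⟨i₀, hi₀⟩ := exists_eq_ciInf_of_finite (f := u)
  set m := ⨅ i, u i
  have hm0 : 0 < m := hi₀ ▸ hu i₀
  have hm1 : m ≤ 1 := hi₀ ▸ hu1 i₀
  have hentry : ∀ i, |(1 - A)⁻¹ x i| ≤ 1 / (m ^ 2 * α * β) := by
    intro i
    have hN := inv_one_sub_nonneg hA hu hpow x i
    obtain ⟨k, j, hk, hj⟩ := hcond' i
    rw [abs_of_nonneg hN, le_div_iff₀ (by positivity)]
    calc (1 - A)⁻¹ x i * (m ^ 2 * α * β) = α * β * m ^ 2 * (1 - A)⁻¹ x i := by ring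
      _ ≤ α * β * u j * (1 - A)⁻¹ x i := by
          have : m ^ 2 ≤ u j := le_trans (by nlinarith) (hmin j)
          gcongr
      _ ≤ u x := inv_one_sub_entry_le hA hu hAu hβ0 hpow hk hj x
      _ ≤ 1 := hu1 x
  calc ∑ i, |(1 - A)⁻¹ x i| ≤ ∑ _i : Fin n, 1 / (m ^ 2 * α * β) :=
        Finset.sum_le_sum fun i _ => hentry i
    _ = n / (m ^ 2 * α * β) := by simp [div_eq_mul_inv]
end
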